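/- arXiv:1507.00760 — 10 statements merged into one kernel-verified Lean document; each statement's English description precedes it below -/
import Mathlib

section
/- Let R be an associative unital ℂ-algebra, N ≥ 2 an integer, q ∈ ℂ a primitive N-th root of unity, v, w ∈ R, and l an integer. Define the sequence ξ_0 = w and ξ_{j+1} = v·ξ_j − q^{l+j}·ξ_j·v for j ≥ 0 (the N-fold iterated graded q-commutator with v applied to an element regarded as having degree l). Then ξ_N = v^N·w − w·v^N. -/
open Polynomial in
/-- The product of `X - ζ` over `N` consecutive integer powers `ζ` of a primitive `N`-th root of
unity is `X ^ N - 1`. -/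
theorem IsPrimitiveRoot.prod_X_sub_C_zpow_add {K : Type*} [Field K] {N : ℕ} (hN : 0 < N) {q : K}
    (hq : IsPrimitiveRoot q N) (l : ℤ) :
    ∏ j ∈ Finset.range N, (X - C (q ^ (l + (j : ℤ)))) = X ^ N - 1 := by
  classical
  have hq0 : q ≠ 0 := hq.ne_zero hN.ne'
  have hinj : Set.InjOn (fun j : ℕ => q ^ (l + (j : ℤ))) (Finset.range N) := by
    intro i hi j hj hij
    simp only [zpow_add₀ hq0, zpow_natCast] at hij
    exact hq.pow_inj (Finset.mem_range.mp hi) (Finset.mem_range.mp hj)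
      (mul_left_cancel₀ (zpow_ne_zero l hq0) hij)
  have himage : (Finset.range N).image (fun j : ℕ => q ^ (l + (j : ℤ))) =
      nthRootsFinset N (1 : K) := by
    refine Finset.eq_of_subset_of_card_le ?_ ?_
    · intro z hz
      obtain ⟨j, -, rfl⟩ := Finset.mem_image.mp hz
      rw [Polynomial.mem_nthRootsFinset hN, ← zpow_natCast, zpow_comm, zpow_natCast, hq.pow_eq_one, one_zpow]
    · rw [Finset.card_image_of_injOn hinj, hq.card_nthRootsFinset, Finset.card_range]
  rw [X_pow_sub_one_eq_prod hN hq, ← himage, Finset.prod_image hinj]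

open Polynomial in
/-- The iterated twisted commutators `ξ (j + 1) = v * ξ j - c j • (ξ j * v)` are obtained by
homogenizing `∏ i < j, (X - c i)` and letting the two variables act by left and right
multiplication by `v`. -/
theorem iterated_twisted_commutator_eq_sum {K R : Type*} [CommRing K] [Ring R] [Algebra K R]
    (v : R) (c : ℕ → K) (ξ : ℕ → R)
    (hrec : ∀ j, ξ (j + 1) = v * ξ j - c j • (ξ j * v)) (j : ℕ) :
    ξ j = ∑ p ∈ Finset.HasAntidiagonal.antidiagonal j,
      (∏ i ∈ Finset.range j, (X - C (c i))).coeff p.1 • (v ^ p.1 * ξ 0 * v ^ p.2) := by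
  induction j with
  | zero => simp
  | succ j ih =>
    set P : K[X] := ∏ i ∈ Finset.range j, (X - C (c i)) with hP
    have hcoeff : P.coeff (j + 1) = 0 := by
      refine coeff_eq_zero_of_natDegree_lt (Nat.lt_succ_of_le ?_)
      refine (natDegree_prod_le _ _).trans ?_
      refine (Finset.sum_le_card_nsmul _ _ 1 fun i _ => natDegree_X_sub_C_le (c i)).trans ?_
      simp
    rw [hrec, Finset.prod_range_succ, ← hP]
    simp only [mul_sub, coeff_sub, coeff_mul_C, sub_smul, Finset.sum_sub_distrib]
    congr 1
    · rw [Finset.Nat.sum_antidiagonal_succ, ih, Finset.mul_sum]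
      simp [coeff_mul_X, pow_succ', mul_assoc]
    · rw [Finset.Nat.sum_antidiagonal_succ', ih, Finset.sum_mul, Finset.smul_sum]
      simp [hcoeff, pow_succ, mul_assoc, smul_smul, mul_comm]


/-- Let `R` be an associative unital ℂ-algebra, `N ≥ 2`, `q` a primitive `N`-th root of
unity, `v w ∈ R` and `l` an integer.  The iterated graded `q`-commutator
`ξ 0 = w`, `ξ (j+1) = v * ξ j - q^(l+j) • (ξ j * v)` satisfies
`ξ N = v^N * w - w * v^N`. -/
theorem iterated_graded_q_commutator_pow
    (R : Type*) [Ring R] [Algebra ℂ R]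
    (N : ℕ) (hN : 2 ≤ N) (q : ℂ) (hq : IsPrimitiveRoot q N)
    (v w : R) (l : ℤ) (ξ : ℕ → R)
    (h0 : ξ 0 = w)
    (hrec : ∀ j : ℕ, ξ (j + 1) = v * ξ j - (q ^ (l + (j : ℤ))) • (ξ j * v)) :
    ξ N = v ^ N * w - w * v ^ N := by
  obtain ⟨n, rfl⟩ : ∃ n, N = n + 1 := ⟨N - 1, by lia⟩
  rw [iterated_twisted_commutator_eq_sum v (fun j : ℕ => q ^ (l + (j : ℤ))) ξ hrec,
    hq.prod_X_sub_C_zpow_add (by lia), h0]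
  simp only [Polynomial.coeff_sub, sub_smul, Finset.sum_sub_distrib]
  congr 1
  · rw [Finset.Nat.sum_antidiagonal_succ', Finset.sum_eq_zero]
    · simp
    · intro p hp
      have : p.1 ≠ n + 1 := by
        have := Finset.HasAntidiagonal.mem_antidiagonal.mp hp
        lia
      simp [Polynomial.coeff_X_pow, this]
  · rw [Finset.Nat.sum_antidiagonal_succ]
    simp [Polynomial.coeff_one]
end

section
/- Let A be an associative unital ℂ-algebra with a ℤ_N-grading given by a family of ℂ-submodules 𝒜 : ZMod N → Submodule ℂ A making A a graded algebra, let N ≥ 2, let q ∈ ℂ be a primitive N-th root of unity, and let v ∈ 𝒜 1 be a homogeneous element of degree one. Define the inner graded q-derivation d : A → A by d(a) = Σ_{i ∈ ZMod N} (v·a_i − q^{i}·a_i·v), where a_i denotes the degree-i homogeneous component of a and q^{i} uses the representative of i in {0,…,N−1}. If v^N = 1 or v^N = −1, then d^N = 0, i.e., the N-fold iterate of d is the zero map. -/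
open Polynomial in
/-- Over `N` consecutive powers of a primitive `N`-th root of unity, starting anywhere, the
linear factors multiply to `X ^ N - 1`. -/
theorem IsPrimitiveRoot.prod_X_sub_C_pow_add {K : Type*} [Field K] {N : ℕ} (hN : 0 < N) {q : K}
    (hq : IsPrimitiveRoot q N) (j : ℕ) :
    ∏ k ∈ Finset.range N, (X - C (q ^ (j + k))) = (X ^ N - 1 : K[X]) := by
  have h := X_pow_sub_C_eq_prod (a := (1 : K)) (α := q ^ j) hq hN
    (by rw [← pow_mul, mul_comm, pow_mul, hq.pow_eq_one, one_pow])
  rw [← C_1, h]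
  exact Finset.prod_congr rfl fun k _ => by rw [pow_add, mul_comm]

theorem pow_val_add_natCast {M : Type*} [Monoid M] {N : ℕ} {q : M} [NeZero N] (hq : q ^ N = 1)
    (i : ZMod N) (n : ℕ) : q ^ (i + (n : ZMod N)).val = q ^ (i.val + n) := by
  rw [ZMod.val_add, ZMod.val_natCast, Nat.add_mod_mod, ← pow_eq_pow_mod _ hq]

/-- Conjugation `y ↦ v * y * w`; when `w` is an inverse of `v`, the operators
`y ↦ v * y - c • (y * v)` factor through `conjEnd v w - c`. -/
def conjEnd {A : Type*} [Ring A] [Algebra ℂ A] (v w : A) : Module.End ℂ A :=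
  LinearMap.mulLeft ℂ v * LinearMap.mulRight ℂ w

theorem conjEnd_pow_apply {A : Type*} [Ring A] [Algebra ℂ A] (v w : A) (n : ℕ) (y : A) :
    (conjEnd v w ^ n) y = v ^ n * y * w ^ n := by
  induction n with
  | zero => simp
  | succ n ih =>
    rw [pow_succ', Module.End.mul_apply, ih, pow_succ' v, pow_succ w]
    simp [conjEnd, mul_assoc]

open Polynomial in
/-- Iterates of a map acting on `𝒜 i` by `x ↦ v * x - q ^ i • (x * v)`, for `v` of degree one
with left inverse `w`. -/
theorem iterate_innerDerivation_eq
    {A : Type*} [Ring A] [Algebra ℂ A] {N : ℕ} [NeZero N] {q : ℂ} (hq : q ^ N = 1)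
    (𝒜 : ZMod N → Submodule ℂ A) [GradedAlgebra 𝒜] {v w : A} (hv : v ∈ 𝒜 1) (hwv : w * v = 1)
    {d : A → A} (hd : ∀ i, ∀ x ∈ 𝒜 i, d x = v * x - q ^ i.val • (x * v))
    {i : ZMod N} {u : A} (hu : u ∈ 𝒜 i) (n : ℕ) :
    d^[n] u ∈ 𝒜 (i + n) ∧
      d^[n] u = aeval (conjEnd v w) (∏ k ∈ Finset.range n, (X - C (q ^ (i.val + k)))) u
        * v ^ n := by
  induction n with
  | zero => simpa using hu
  | succ n ih =>
    obtain ⟨hmem, heq⟩ := ih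
    rw [Function.iterate_succ_apply', hd _ _ hmem]
    constructor
    · have h1 : v * d^[n] u ∈ 𝒜 (i + (n + 1 : ℕ)) := by
        have := SetLike.mul_mem_graded hv hmem
        rwa [show 1 + (i + (n : ZMod N)) = i + (n + 1 : ℕ) by push_cast; ring] at this
      have h2 : d^[n] u * v ∈ 𝒜 (i + (n + 1 : ℕ)) := by
        have := SetLike.mul_mem_graded hmem hv
        rwa [show i + (n : ZMod N) + 1 = i + (n + 1 : ℕ) by push_cast; ring] at this
      exact Submodule.sub_mem _ h1 (Submodule.smul_mem _ _ h2)
    · rw [Finset.prod_range_succ_comm, map_mul, Module.End.mul_apply, heq,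
        pow_val_add_natCast hq]
      generalize aeval (conjEnd v w) (∏ k ∈ Finset.range n, (X - C (q ^ (i.val + k)))) u = y
      have hw : w * v ^ (n + 1) = v ^ n := by rw [pow_succ', ← mul_assoc, hwv, one_mul]
      rw [map_sub, aeval_X, aeval_C, LinearMap.sub_apply, Module.algebraMap_end_apply, sub_mul,
        smul_mul_assoc, mul_assoc y, ← pow_succ]
      simp [conjEnd, mul_assoc, hw]


/-- Let `A` be a `ℤ_N`-graded associative unital ℂ-algebra, `N ≥ 2`, `q` a primitive
`N`-th root of unity and `v` a homogeneous element of degree one.  If the inner graded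
`q`-derivation `d a = ∑ i, (v * aᵢ - q^i • (aᵢ * v))` is induced by `v` with `v^N = 1`
or `v^N = -1`, then `d` is an `N`-differential: `d^N = 0`. -/
theorem inner_graded_q_derivation_N_differential
    (A : Type*) [Ring A] [Algebra ℂ A]
    (N : ℕ) [NeZero N] (hN : 2 ≤ N)
    (q : ℂ) (hq : IsPrimitiveRoot q N)
    (𝒜 : ZMod N → Submodule ℂ A) [GradedAlgebra 𝒜]
    (v : A) (hv : v ∈ 𝒜 1)
    (d : A → A)
    (hd : ∀ a : A, d a =
      ∑ i : ZMod N,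
        (v * (DirectSum.decompose 𝒜 a i : A)
          - q ^ (i.val) • ((DirectSum.decompose 𝒜 a i : A) * v)))
    (hvN : v ^ N = 1 ∨ v ^ N = -1) :
    ∀ a : A, d^[N] a = 0 := by
  have hN0 : 0 < N := by omega
  have hd_hom : ∀ i, ∀ x ∈ 𝒜 i, d x = v * x - q ^ i.val • (x * v) := by
    intro i x hx
    rw [hd, Finset.sum_eq_single i]
    · rw [DirectSum.decompose_of_mem_same 𝒜 hx]
    · intro j _ hj
      rw [DirectSum.decompose_of_mem_ne 𝒜 hx hj.symm]
      simp
    · simp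
  have hd_add : ∀ a b, d (a + b) = d a + d b := by
    intro a b
    rw [hd, hd a, hd b, ← Finset.sum_add_distrib]
    refine Finset.sum_congr rfl fun i _ => ?_
    rw [DirectSum.decompose_add, DirectSum.add_apply, Submodule.coe_add, mul_add, add_mul,
      smul_add]
    abel
  obtain ⟨w, hwv, hwvN⟩ : ∃ w, w * v = 1 ∧ w ^ N * v ^ N = 1 := by
    obtain ⟨m, rfl⟩ : ∃ m, N = m + 1 := ⟨N - 1, by omega⟩
    obtain ⟨w, hwv, hvw⟩ : ∃ w, w * v = 1 ∧ v * w = 1 := by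
      rcases hvN with h | h
      · exact ⟨v ^ m, by rw [← pow_succ, h], by rw [← pow_succ', h]⟩
      · exact ⟨-v ^ m, by rw [neg_mul, ← pow_succ, h, neg_neg],
          by rw [mul_neg, ← pow_succ', h, neg_neg]⟩
    have hcomm : Commute w v := hwv.trans hvw.symm
    exact ⟨w, hwv, by rw [← hcomm.mul_pow, hwv, one_pow]⟩
  have hcentral : ∀ u : A, v ^ N * u = u * v ^ N := by
    intro u
    rcases hvN with h | h <;> simp [h]
  have hd_zero : d 0 = 0 := by simpa using hd_add 0 0
  intro a
  induction a using DirectSum.Decomposition.inductionOn 𝒜 with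
  | zero => exact Function.iterate_fixed hd_zero N
  | @homogeneous i u =>
    rw [(iterate_innerDerivation_eq hq.pow_eq_one 𝒜 hv hwv hd_hom u.2 N).2,
      hq.prod_X_sub_C_pow_add hN0]
    simp [conjEnd_pow_apply, hcentral, mul_assoc, hwvN]
  | add a b ha hb =>
    have h : d^[N] (a + b) = d^[N] a + d^[N] b :=
      iterate_map_add (AddMonoidHom.mk' d hd_add) N a b
    rw [h, ha, hb, add_zero]
end

section
/- Let Ã be an associative unital ℂ-algebra, A ⊆ Ã a subalgebra, N ≥ 2 an integer, and τ ∈ Ã a unit with τ^N = 1 such that for every a ∈ A there exists b ∈ A with a·τ = τ·b and for every a ∈ A there exists c ∈ A with τ·a = c·τ. Then the subalgebra of Ã generated by A together with τ (the Galois extension A[τ]) equals, as a ℂ-subspace of Ã, the sum of the right A-modules generated by the powers of τ: A[τ] = Σ_{k=0}^{N−1} {τ^k·a : a ∈ A}. -/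
theorem exists_mul_pow_eq_pow_mul {M S : Type*} [Monoid M] [SetLike S M] (s : S) {x : M}
    (h : ∀ a ∈ s, ∃ b ∈ s, a * x = x * b) (j : ℕ) :
    ∀ a ∈ s, ∃ b ∈ s, a * x ^ j = x ^ j * b := by
  induction j with
  | zero => exact fun a ha => ⟨a, ha, by simp⟩
  | succ j ih =>
    intro a ha
    obtain ⟨b, hb, hab⟩ := ih a ha
    obtain ⟨c, hc, hbc⟩ := h b hb
    exact ⟨c, hc, by rw [pow_succ, ← mul_assoc, hab, mul_assoc, hbc, mul_assoc]⟩

namespace Subalgebra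

variable {R B : Type*} [CommSemiring R] [Semiring B] [Algebra R B]

/-- The sum of the right `A`-modules generated by `x ^ 0, …, x ^ (N - 1)`. -/
def powSum (A : Subalgebra R B) (x : B) (N : ℕ) : Submodule R B :=
  LinearMap.range (∑ k : Fin N,
    LinearMap.mulLeft R (x ^ (k : ℕ)) ∘ₗ A.val.toLinearMap ∘ₗ LinearMap.proj k)

variable {A : Subalgebra R B} {x : B} {N : ℕ}

theorem mem_powSum {y : B} :
    y ∈ A.powSum x N ↔ ∃ u : Fin N → A, y = ∑ k : Fin N, x ^ (k : ℕ) * (u k : B) := by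
  simp [powSum, LinearMap.sum_apply, eq_comm]

theorem pow_mul_mem_powSum (hN : N ≠ 0) (hx : x ^ N = 1) (k : ℕ) {a : B} (ha : a ∈ A) :
    x ^ k * a ∈ A.powSum x N := by
  rw [mem_powSum]
  refine ⟨Pi.single ⟨k % N, Nat.mod_lt _ (Nat.pos_of_ne_zero hN)⟩ ⟨a, ha⟩, ?_⟩
  rw [Finset.sum_eq_single ⟨k % N, Nat.mod_lt _ (Nat.pos_of_ne_zero hN)⟩]
  · simp [← pow_eq_pow_mod k hx]
  · intro j _ hj
    simp [Pi.single_eq_of_ne hj]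
  · simp

theorem mul_mem_powSum (hN : N ≠ 0) (hx : x ^ N = 1)
    (h : ∀ a ∈ A, ∃ b ∈ A, a * x = x * b) {y z : B}
    (hy : y ∈ A.powSum x N) (hz : z ∈ A.powSum x N) : y * z ∈ A.powSum x N := by
  obtain ⟨u, rfl⟩ := mem_powSum.1 hy
  obtain ⟨v, rfl⟩ := mem_powSum.1 hz
  rw [Finset.sum_mul_sum]
  refine sum_mem fun i _ => sum_mem fun j _ => ?_
  obtain ⟨b, hb, hab⟩ := exists_mul_pow_eq_pow_mul A h j (u i) (u i).2
  have key : x ^ (i : ℕ) * (u i : B) * (x ^ (j : ℕ) * (v j : B)) =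
      x ^ ((i : ℕ) + j) * (b * v j) := by
    rw [mul_assoc, ← mul_assoc (u i : B), hab, pow_add]
    simp only [mul_assoc]
  rw [key]
  exact pow_mul_mem_powSum hN hx _ (mul_mem hb (v j).2)

theorem toSubmodule_adjoin_union_singleton_eq_powSum (hN : N ≠ 0) (hx : x ^ N = 1)
    (h : ∀ a ∈ A, ∃ b ∈ A, a * x = x * b) :
    toSubmodule (Algebra.adjoin R ((A : Set B) ∪ {x})) = A.powSum x N := by
  have hA : ∀ a ∈ A, a ∈ A.powSum x N := fun a ha => by
    simpa using pow_mul_mem_powSum hN hx 0 ha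
  apply le_antisymm
  · intro y hy
    rw [mem_toSubmodule] at hy
    induction hy using Algebra.adjoin_induction with
    | mem y hy =>
      rcases hy with hy | rfl
      · exact hA y hy
      · simpa using pow_mul_mem_powSum hN hx 1 (one_mem A)
    | algebraMap r => exact hA _ (A.algebraMap_mem r)
    | add y z _ _ hy hz => exact add_mem hy hz
    | mul y z _ _ hy hz => exact mul_mem_powSum hN hx h hy hz
  · intro y hy
    obtain ⟨u, rfl⟩ := mem_powSum.1 hy
    rw [mem_toSubmodule]
    exact sum_mem fun k _ => mul_mem
      (pow_mem (Algebra.subset_adjoin (Set.mem_union_right _ (Set.mem_singleton x))) _)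
      (Algebra.subset_adjoin (Set.mem_union_left _ (u k).2))

end Subalgebra


/-- Let `B` be an associative unital ℂ-algebra, `A` a subalgebra, `N ≥ 2` and `τ` a unit
with `τ^N = 1` such that `A·τ ⊆ τ·A` and `τ·A ⊆ A·τ`.  Then the subalgebra generated by
`A` and `τ` (the Galois extension `A[τ]`) equals, as a subset of `B`, the sum of the
right `A`-modules generated by the powers `τ^0, τ^1, …, τ^(N-1)`. -/
theorem galois_extension_eq_sum_of_right_modules
    (B : Type*) [Ring B] [Algebra ℂ B]
    (A : Subalgebra ℂ B)
    (N : ℕ) (hN : 2 ≤ N)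
    (τ : Bˣ) (hτ : (τ : B) ^ N = 1)
    (hlr : ∀ a ∈ A, ∃ b ∈ A, a * (τ : B) = (τ : B) * b)
    (hrl : ∀ a ∈ A, ∃ c ∈ A, (τ : B) * a = c * (τ : B)) :
    (Algebra.adjoin ℂ ((A : Set B) ∪ {(τ : B)}) : Set B) =
      {x : B | ∃ u : Fin N → A, x = ∑ k : Fin N, (τ : B) ^ (k : ℕ) * (u k : B)} := by
  ext y
  rw [SetLike.mem_coe, ← Subalgebra.mem_toSubmodule,
    Subalgebra.toSubmodule_adjoin_union_singleton_eq_powSum (by omega) hτ hlr]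
  exact Subalgebra.mem_powSum
end

section
/- Let R be an associative unital ℂ-algebra, N ≥ 2 an integer, q ∈ ℂ a primitive N-th root of unity, and τ ∈ R a unit with τ^N = 1. Fix an integer k with 0 ≤ k ≤ N−1 and an element u ∈ R, and define the sequence ξ_0 = τ^k·u and ξ_{j+1} = τ·ξ_j − q^{k+j}·ξ_j·τ (the iterated inner graded q-derivation induced by τ applied to the degree-k element τ^k u). Then ξ_N = 0; i.e., the inner graded q-derivation d = [τ, ·]_q of the semi-commutative Galois extension is an N-differential, d^N = 0. -/
/-- The `n`-th power of conjugation by `τ` is conjugation by `τ ^ n`. -/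
theorem conj_linearMap_pow_apply {R : Type*} [Ring R] [Algebra ℂ R] (τ : Rˣ) (n : ℕ) (x : R) :
    ((LinearMap.mulLeft ℂ (τ : R) ∘ₗ LinearMap.mulRight ℂ ((τ⁻¹ : Rˣ) : R)) ^ n) x =
      ((τ ^ n : Rˣ) : R) * x * ((τ⁻¹ ^ n : Rˣ) : R) := by
  induction n with
  | zero => simp
  | succ n ih =>
    rw [pow_succ', Module.End.mul_apply, ih, pow_succ' τ, pow_succ τ⁻¹]
    simp only [LinearMap.comp_apply, LinearMap.mulLeft_apply, LinearMap.mulRight_apply,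
      Units.val_mul, mul_assoc]

open Polynomial in
/-- Twisting by powers of `τ⁻¹` turns the iterated `q`-derivation into the product of the factors
`X - q ^ (k + i)` evaluated at conjugation by `τ`. -/
theorem iterate_q_derivation_mul_inv_pow {R : Type*} [Ring R] [Algebra ℂ R] (q : ℂ) (τ : Rˣ)
    (k : ℕ) (ξ : ℕ → R)
    (hrec : ∀ j : ℕ, ξ (j + 1) = (τ : R) * ξ j - q ^ (k + j) • (ξ j * (τ : R))) (n : ℕ) :
    ξ n * ((τ⁻¹ ^ n : Rˣ) : R) =
      aeval (LinearMap.mulLeft ℂ (τ : R) ∘ₗ LinearMap.mulRight ℂ ((τ⁻¹ : Rˣ) : R))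
        (∏ i ∈ Finset.range n, (X - C (q ^ i * q ^ k))) (ξ 0) := by
  induction n with
  | zero => simp
  | succ n ih =>
    rw [Finset.prod_range_succ_comm, map_mul, Module.End.mul_apply, ← ih, hrec, pow_succ τ⁻¹,
      ← pow_add, add_comm n k]
    have hcomm : (τ : R) * (((τ⁻¹ ^ n : Rˣ) : R) * ((τ⁻¹ : Rˣ) : R)) = ((τ⁻¹ ^ n : Rˣ) : R) := by
      rw [← Units.val_mul, ← Units.val_mul, ← pow_succ, pow_succ', mul_inv_cancel_left]
    simp only [map_sub, aeval_X, aeval_C, LinearMap.sub_apply, LinearMap.comp_apply,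
      LinearMap.mulLeft_apply, LinearMap.mulRight_apply, Module.algebraMap_end_apply,
      Units.val_mul, sub_mul, smul_mul_assoc, mul_assoc, hcomm]


/-- Let `R` be an associative unital ℂ-algebra, `N ≥ 2`, `q` a primitive `N`-th root of
unity and `τ` a unit with `τ^N = 1`.  For `0 ≤ k ≤ N-1` and `u ∈ R`, the iterated inner
graded `q`-derivation induced by `τ` applied to the degree-`k` element `τ^k * u`,
`ξ 0 = τ^k * u`, `ξ (j+1) = τ * ξ j - q^(k+j) • (ξ j * τ)`, satisfies `ξ N = 0`;
i.e. `d = [τ, ·]_q` is an `N`-differential. -/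
theorem inner_q_derivation_is_N_differential
    (R : Type*) [Ring R] [Algebra ℂ R]
    (N : ℕ) (hN : 2 ≤ N) (q : ℂ) (hq : IsPrimitiveRoot q N)
    (τ : Rˣ) (hτ : (τ : R) ^ N = 1)
    (k : ℕ) (hk : k ≤ N - 1) (u : R)
    (ξ : ℕ → R)
    (h0 : ξ 0 = (τ : R) ^ k * u)
    (hrec : ∀ j : ℕ, ξ (j + 1) = (τ : R) * ξ j - q ^ (k + j) • (ξ j * (τ : R))) :
    ξ N = 0 := by
  have hN0 : 0 < N := by omega
  have hτN : τ ^ N = 1 := Units.ext (by simpa using hτ)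
  have hqk : (q ^ k) ^ N = 1 := by rw [← pow_mul, mul_comm, pow_mul, hq.pow_eq_one, one_pow]
  have h := iterate_q_derivation_mul_inv_pow q τ k ξ hrec N
  rw [← X_pow_sub_C_eq_prod hq hN0 hqk] at h
  simpa [conj_linearMap_pow_apply, hτN, inv_pow] using h
end

section
/- In the real quaternions ℍ, write every quaternion uniquely as 𝔮 = 𝔮₊ + 𝔮₋ where 𝔮₊ lies in the real span of {1, j} (the even part) and 𝔮₋ lies in the real span of {i, k} (the odd part). Define d : ℍ → ℍ by d(𝔮) = i·𝔮₊ − 𝔮₊·i + i·𝔮₋ + 𝔮₋·i. Then d² = 0, i.e., d(d(𝔮)) = 0 for every quaternion 𝔮. -/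
open Quaternion

/-- The quaternion `i`. -/
def Quaternion.I : ℍ[ℝ] := ⟨0, 1, 0, 0⟩

/-- The quaternion `j`. -/
def Quaternion.J : ℍ[ℝ] := ⟨0, 0, 1, 0⟩

/-- The quaternion `k`. -/
def Quaternion.K : ℍ[ℝ] := ⟨0, 0, 0, 1⟩

@[simp] theorem Quaternion.re_I : Quaternion.I.re = 0 := rfl

@[simp] theorem Quaternion.imI_I : Quaternion.I.imI = 1 := rfl

@[simp] theorem Quaternion.imJ_I : Quaternion.I.imJ = 0 := rfl

@[simp] theorem Quaternion.imK_I : Quaternion.I.imK = 0 := rfl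

@[simp] theorem Quaternion.imI_J : Quaternion.J.imI = 0 := rfl

@[simp] theorem Quaternion.imK_J : Quaternion.J.imK = 0 := rfl

@[simp] theorem Quaternion.re_K : Quaternion.K.re = 0 := rfl

@[simp] theorem Quaternion.imJ_K : Quaternion.K.imJ = 0 := rfl

/-- The real span of `{1, j}` consists of quaternions without `i`- and `k`-component. -/
theorem Quaternion.imI_imK_eq_zero_of_mem_span_one_J {x : ℍ[ℝ]}
    (hx : x ∈ Submodule.span ℝ ({1, Quaternion.J} : Set ℍ[ℝ])) :
    x.imI = 0 ∧ x.imK = 0 := by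
  obtain ⟨a, b, rfl⟩ := Submodule.mem_span_pair.mp hx
  simp

/-- The real span of `{i, k}` consists of quaternions without real part and `j`-component. -/
theorem Quaternion.re_imJ_eq_zero_of_mem_span_I_K {x : ℍ[ℝ]}
    (hx : x ∈ Submodule.span ℝ ({Quaternion.I, Quaternion.K} : Set ℍ[ℝ])) :
    x.re = 0 ∧ x.imJ = 0 := by
  obtain ⟨a, b, rfl⟩ := Submodule.mem_span_pair.mp hx
  simp

/-- Writing each quaternion `𝔮 = 𝔮₊ + 𝔮₋` with `𝔮₊` in the real span of `{1, j}` (even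
part) and `𝔮₋` in the real span of `{i, k}` (odd part), the inner graded
`(-1)`-derivation `d 𝔮 = i·𝔮₊ - 𝔮₊·i + i·𝔮₋ + 𝔮₋·i` induced by `i` satisfies
`d² = 0`. -/
theorem quaternion_inner_derivation_sq_zero
    (p m : ℍ[ℝ] → ℍ[ℝ])
    (hp : ∀ q : ℍ[ℝ],
      p q ∈ Submodule.span ℝ ({1, Quaternion.J} : Set ℍ[ℝ]))
    (hm : ∀ q : ℍ[ℝ],
      m q ∈ Submodule.span ℝ ({Quaternion.I, Quaternion.K} : Set ℍ[ℝ]))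
    (hpm : ∀ q : ℍ[ℝ], p q + m q = q)
    (d : ℍ[ℝ] → ℍ[ℝ])
    (hd : ∀ q : ℍ[ℝ],
      d q = Quaternion.I * p q - p q * Quaternion.I
        + (Quaternion.I * m q + m q * Quaternion.I)) :
    ∀ q : ℍ[ℝ], d (d q) = 0 := by
  have key : ∀ q : ℍ[ℝ], d q = ⟨-2 * q.imI, 0, 0, 2 * q.imJ⟩ := by
    intro q
    obtain ⟨hpI, hpK⟩ := Quaternion.imI_imK_eq_zero_of_mem_span_one_J (hp q)
    obtain ⟨hmR, hmJ⟩ := Quaternion.re_imJ_eq_zero_of_mem_span_I_K (hm q)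
    have hI : (m q).imI = q.imI := by
      simpa [hpI] using congrArg (fun x : ℍ[ℝ] => x.imI) (hpm q)
    have hJ : (p q).imJ = q.imJ := by
      simpa [hmJ] using congrArg (fun x : ℍ[ℝ] => x.imJ) (hpm q)
    rw [hd q]
    ext <;> simp [hpI, hpK, hmR, hmJ, hI, hJ] <;> ring
  intro q
  rw [key (d q), key q]
  ext <;> simp
end

section
/- Let A be an associative unital ℂ-algebra, N ≥ 2 an integer, q ∈ ℂ a primitive N-th root of unity, and φ : A → A a ℂ-linear map with φ^N = id_A. For x ∈ A define the sequence of elements P_k(x) by P_1(x) = x − φ(x) and P_{k+1}(x) = P_k(x) − q^k·φ(P_k(x)) for k = 1, 2, …, N−1. Then P_N(x) = 0 and P_{N−1}(x) + φ(P_{N−1}(x)) + φ²(P_{N−1}(x)) + … + φ^{N−1}(P_{N−1}(x)) = 0. -/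
/-- If `ζ` is a primitive `n`-th root of unity in a domain, then
`∏_{k < n} (x - ζ ^ k * y) = x ^ n - y ^ n`. -/
theorem IsPrimitiveRoot.prod_range_sub_pow_mul {R : Type*} [CommRing R] [IsDomain R] {ζ : R}
    {n : ℕ} (hn : 0 < n) (hζ : IsPrimitiveRoot ζ n) (x y : R) :
    ∏ k ∈ Finset.range n, (x - ζ ^ k * y) = x ^ n - y ^ n := by
  rw [hζ.pow_sub_pow_eq_prod_sub_mul x y hn]
  have : NeZero n := ⟨hn.ne'⟩
  refine Finset.prod_nbij (fun k => ζ ^ k) ?_ ?_ ?_ fun _ _ => rfl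
  · intro k _
    rw [Polynomial.mem_nthRootsFinset hn, ← pow_mul, mul_comm, pow_mul, hζ.pow_eq_one, one_pow]
  · intro i hi j hj hij
    exact hζ.pow_inj (by simpa using hi) (by simpa using hj) hij
  · intro z hz
    obtain ⟨i, hi, rfl⟩ := hζ.eq_pow_of_pow_eq_one ((Polynomial.mem_nthRootsFinset hn _).1 hz)
    exact ⟨i, by simpa using hi, rfl⟩

/-- Let `A` be an associative unital ℂ-algebra, `N ≥ 2`, `q` a primitive `N`-th root of
unity and `φ : A → A` a ℂ-linear map with `φ^N = id`.  For `x ∈ A` define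
`P 1 = x - φ x` and `P (k+1) = P k - q^k • φ (P k)` for `k = 1, …, N-1`.  Then
`P N = 0` and `P (N-1) + φ (P (N-1)) + … + φ^(N-1) (P (N-1)) = 0`. -/
theorem P_N_eq_zero_and_trace_P_N_sub_one_eq_zero
    (A : Type*) [Ring A] [Algebra ℂ A]
    (N : ℕ) (hN : 2 ≤ N) (q : ℂ) (hq : IsPrimitiveRoot q N)
    (φ : A →ₗ[ℂ] A) (hφ : (⇑φ)^[N] = id)
    (x : A) (P : ℕ → A)
    (hP1 : P 1 = x - φ x)
    (hPrec : ∀ k : ℕ, 1 ≤ k → k ≤ N - 1 → P (k + 1) = P k - q ^ k • φ (P k)) :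
    P N = 0 ∧ ∑ j ∈ Finset.range N, (⇑φ)^[j] (P (N - 1)) = 0 := by
  have hpow : φ ^ N = 1 := by
    ext a
    rw [Module.End.pow_apply, hφ]
    rfl
  constructor
  · have hP : ∀ k, 1 ≤ k → k ≤ N → P k =
        Polynomial.aeval φ (∏ i ∈ Finset.range k,
          (1 - Polynomial.C q ^ i * Polynomial.X)) x := by
      intro k hk
      induction k, hk using Nat.le_induction with
      | base => intro _; simp [hP1]
      | succ k hk ih =>
        intro hkN
        rw [hPrec k hk (by omega), Finset.prod_range_succ, mul_comm, map_mul,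
          Module.End.mul_apply, ← ih (by omega), ← map_pow, ← Polynomial.smul_eq_C_mul]
        simp
    rw [hP N (by omega) le_rfl, (hq.map_of_injective Polynomial.C_injective).prod_range_sub_pow_mul
      (by omega)]
    simp [hpow]
  · have hS : ∀ k, 1 ≤ k → k ≤ N → (∑ j ∈ Finset.range N, φ ^ j) (P k) = 0 := by
      intro k hk
      induction k, hk using Nat.le_induction with
      | base =>
        intro _
        have h : (∑ j ∈ Finset.range N, φ ^ j) * (1 - φ) = 0 := by
          rw [geom_sum_mul_neg, hpow, sub_self]
        simpa [hP1] using LinearMap.congr_fun h x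
      | succ k hk ih =>
        intro hkN
        have hcomm : Commute (∑ j ∈ Finset.range N, φ ^ j) φ :=
          Commute.sum_left _ _ _ fun j _ => Commute.pow_self φ j
        have h := LinearMap.congr_fun hcomm.eq (P k)
        rw [Module.End.mul_apply, Module.End.mul_apply, ih (by omega), map_zero] at h
        rw [hPrec k hk (by omega), map_sub, map_smul, ih (by omega), h, smul_zero, sub_zero]
    simpa [LinearMap.sum_apply, Module.End.pow_apply] using hS (N - 1) (by omega) (by omega)
end

section
/- Let R be an associative unital ℂ-algebra, τ ∈ R a unit, q ∈ ℂ, φ(u) = τ⁻¹·u·τ, and x ∈ R. Define P_1(x) = x − φ(x) and P_{k+1}(x) = P_k(x) − q^k·φ(P_k(x)), and define the iterated differential of x by η_0 = x, η_{j+1} = τ·η_j − q^j·η_j·τ (application of the inner graded q-derivation induced by τ to the degree-j element η_j). Then for every k ≥ 1 one has η_k = τ^k·P_k(x), i.e., d^k x = τ^k·P_k(x). -/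
/-- Let `R` be an associative unital ℂ-algebra, `τ` a unit, `q ∈ ℂ`,
`φ u = τ⁻¹ * u * τ`, and `x ∈ R`.  With `P 1 = x - φ x`,
`P (k+1) = P k - q^k • φ (P k)` and the iterated differential
`η 0 = x`, `η (j+1) = τ * η j - q^j • (η j * τ)`, one has `η k = τ^k * P k`
for every `k ≥ 1`, i.e. `d^k x = τ^k * P_k(x)`. -/
theorem iterated_differential_eq_tau_pow_mul_P
    (R : Type*) [Ring R] [Algebra ℂ R]
    (τ : Rˣ) (q : ℂ) (φ : R → R)
    (hφ : ∀ u : R, φ u = (↑τ⁻¹ : R) * u * (τ : R))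
    (x : R) (P : ℕ → R)
    (hP1 : P 1 = x - φ x)
    (hPrec : ∀ k : ℕ, 1 ≤ k → P (k + 1) = P k - q ^ k • φ (P k))
    (η : ℕ → R)
    (hη0 : η 0 = x)
    (hηrec : ∀ j : ℕ, η (j + 1) = (τ : R) * η j - q ^ j • (η j * (τ : R))) :
    ∀ k : ℕ, 1 ≤ k → η k = (τ : R) ^ k * P k := by
  intro k hk
  induction k, hk using Nat.le_induction with
  | base =>
    have h := hηrec 0
    rw [hη0, zero_add, pow_zero, one_smul] at h
    rw [h, hP1, hφ, pow_one, mul_sub, mul_assoc (↑τ⁻¹ : R), Units.mul_inv_cancel_left]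
  | succ k hk ih =>
    rw [hηrec, ih, hPrec k hk, hφ, mul_sub, mul_smul_comm, ← mul_assoc (τ : R), ← pow_succ',
      pow_succ (τ : R) k, mul_assoc (↑τ⁻¹ : R), mul_assoc _ (τ : R) (_ * _),
      Units.mul_inv_cancel_left, ← mul_assoc _ (P k) (τ : R)]
end

section
/- Let R be an associative unital ℂ-algebra, τ ∈ R a unit, q ∈ ℂ, φ(u) = τ⁻¹·u·τ, and x ∈ R with Δx = x − φ(x) invertible. Set dx = τ·Δx, Q_2(x) = φ(Δx)·Δx (which is invertible), P_2(x) = x − (1+q)·φ(x) + q·φ²(x), and for u ∈ R set u′_x = (Δx)⁻¹·(u − φ(u)). Then for every u ∈ R the differential of the 1-form ω = dx·u, namely dω = τ·(dx·u) − q·(dx·u)·τ, satisfies dω = (dx)²·(q·u′_x + Q_2(x)⁻¹·P_2(x)·u). -/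
/-- Let `R` be an associative unital ℂ-algebra, `τ` a unit, `q ∈ ℂ`,
`φ u = τ⁻¹ * u * τ`, and `x ∈ R` with `Δx = x - φ x` invertible.  Set `dx = τ * Δx`,
`Q₂ = φ(Δx) * Δx` (which is invertible), `P₂ = x - (1+q)•φ(x) + q•φ²(x)` and
`u′_x = (Δx)⁻¹ * (u - φ u)`.  Then the differential of the 1-form `ω = dx * u`,
`dω = τ * (dx * u) - q • ((dx * u) * τ)`, satisfies
`dω = (dx)² * (q • u′_x + Q₂⁻¹ * P₂ * u)`. -/
theorem differential_of_one_form
    (R : Type*) [Ring R] [Algebra ℂ R]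
    (τ : Rˣ) (q : ℂ) (φ : R → R)
    (hφ : ∀ u : R, φ u = (↑τ⁻¹ : R) * u * (τ : R))
    (x : R) (hx : IsUnit (x - φ x)) :
    IsUnit (φ (x - φ x) * (x - φ x)) ∧
    ∀ u : R,
      (τ : R) * ((τ : R) * (x - φ x) * u) - q • (((τ : R) * (x - φ x) * u) * (τ : R)) =
        ((τ : R) * (x - φ x)) ^ 2 *
          (q • (Ring.inverse (x - φ x) * (u - φ u)) +
            Ring.inverse (φ (x - φ x) * (x - φ x)) *
              (x - (1 + q) • φ x + q • φ (φ x)) * u) := by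
  have hτφ (v : R) : (τ : R) * φ v = v * τ := by
    rw [hφ, mul_assoc, Units.mul_inv_cancel_left]
  have hsub (v w : R) : φ (v - w) = φ v - φ w := by
    simp only [hφ, mul_sub, sub_mul]
  have hQ : IsUnit (φ (x - φ x) * (x - φ x)) := by
    rw [hφ]
    exact ((τ⁻¹.isUnit.mul hx).mul τ.isUnit).mul hx
  refine ⟨hQ, fun u => ?_⟩
  have hP : x - (1 + q) • φ x + q • φ (φ x) = (x - φ x) - q • φ (x - φ x) := by
    rw [hsub, smul_sub, add_smul, one_smul]
    abel
  rw [hP]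
  generalize x - φ x = D at hx hQ ⊢
  have hsq : ((τ : R) * D) ^ 2 = τ * τ * (φ D * D) := by
    rw [sq, mul_assoc (τ : R) τ, ← mul_assoc (τ : R) (φ D), hτφ]
    simp only [mul_assoc]
  have hderiv : ((τ : R) * D) ^ 2 * (Ring.inverse D * (u - φ u)) =
      τ * D * τ * u - τ * D * u * τ := by
    calc ((τ : R) * D) ^ 2 * (Ring.inverse D * (u - φ u))
        = τ * D * τ * (D * Ring.inverse D) * (u - φ u) := by
          simp only [sq, mul_assoc]
      _ = τ * D * τ * u - τ * D * (τ * φ u) := by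
          rw [Ring.mul_inverse_cancel _ hx, mul_one, mul_sub, mul_assoc _ (τ : R) (φ u)]
      _ = τ * D * τ * u - τ * D * u * τ := by
          rw [hτφ, mul_assoc _ u]
  have hconn : ((τ : R) * D) ^ 2 *
      (Ring.inverse (φ D * D) * (D - q • φ D) * u) =
      τ * (τ * D * u) - q • (τ * D * τ * u) := by
    calc ((τ : R) * D) ^ 2 * (Ring.inverse (φ D * D) * (D - q • φ D) * u)
        = τ * τ * ((φ D * D) * Ring.inverse (φ D * D)) * ((D - q • φ D) * u) := by
          rw [hsq]
          simp only [mul_assoc]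
      _ = τ * (τ * D * u) - q • (τ * (τ * φ D) * u) := by
          rw [Ring.mul_inverse_cancel _ hQ, mul_one]
          simp only [sub_mul, mul_sub, smul_mul_assoc, mul_smul_comm, mul_assoc]
      _ = τ * (τ * D * u) - q • (τ * D * τ * u) := by
          rw [hτφ, ← mul_assoc (τ : R) D (τ : R)]
  rw [mul_add, mul_smul_comm, hderiv, hconn, smul_sub]
  abel
end

section
/- Let R be an associative unital ℂ-algebra and τ ∈ R an element with τ² = 1. Set φ(u) = τ·u·τ and Δu = u − φ(u), and let x ∈ R be such that Δx is invertible. Define the derivative u′_x = (Δx)⁻¹·Δu. Then for every u ∈ R the second derivative vanishes: (u′_x)′_x = (Δx)⁻¹·Δ((Δx)⁻¹·Δu) = 0. In particular Δ((Δx)⁻¹·Δu) = 0, i.e., every element of R has derivative constant (fixed by φ) with respect to x. -/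
theorem mul_sub_conj_eq_neg {R : Type*} [Ring R] {τ : R} (hτ : τ * τ = 1) (u : R) :
    τ * (u - τ * u * τ) = -((u - τ * u * τ) * τ) := by
  have h₁ : τ * (τ * u * τ) = u * τ := by rw [← mul_assoc, ← mul_assoc, hτ, one_mul]
  have h₂ : τ * u * τ * τ = τ * u := by rw [mul_assoc, hτ, mul_one]
  rw [mul_sub, sub_mul, h₁, h₂, neg_sub]

theorem mul_ringInverse_eq_neg {R : Type*} [Ring R] {τ d : R} (hd : IsUnit d)
    (h : τ * d = -(d * τ)) : τ * Ring.inverse d = -(Ring.inverse d * τ) := by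
  obtain ⟨d, rfl⟩ := hd
  rw [Ring.inverse_unit, ← Units.mul_right_inj d, mul_neg, Units.mul_inv_cancel_left,
    ← mul_assoc, ← neg_eq_iff_eq_neg.mpr h, neg_mul, Units.mul_inv_cancel_right]

/-- Let `R` be an associative unital ℂ-algebra and `τ ∈ R` with `τ² = 1`.  With
`φ u = τ * u * τ`, `Δu = u - φ u` and `x ∈ R` such that `Δx` is invertible, the
derivative `u′_x = (Δx)⁻¹ * Δu` of every element `u ∈ R` has vanishing second
derivative: `(u′_x)′_x = 0`; in particular `Δ((Δx)⁻¹ * Δu) = 0`, i.e. every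
derivative is fixed by `φ`. -/
theorem second_derivative_vanishes
    (R : Type*) [Ring R] [Algebra ℂ R]
    (τ : R) (hτ : τ ^ 2 = 1)
    (x : R) (hx : IsUnit (x - τ * x * τ)) :
    ∀ u : R,
      Ring.inverse (x - τ * x * τ) *
        ((Ring.inverse (x - τ * x * τ) * (u - τ * u * τ)) -
          τ * (Ring.inverse (x - τ * x * τ) * (u - τ * u * τ)) * τ) = 0 ∧
      (Ring.inverse (x - τ * x * τ) * (u - τ * u * τ)) -
        τ * (Ring.inverse (x - τ * x * τ) * (u - τ * u * τ)) * τ = 0 := by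
  intro u
  have hτ' : τ * τ = 1 := by rw [← sq, hτ]
  have hinv := mul_ringInverse_eq_neg hx (mul_sub_conj_eq_neg hτ' x)
  have hu := mul_sub_conj_eq_neg hτ' u
  generalize Ring.inverse (x - τ * x * τ) = y at *
  generalize u - τ * u * τ = w at *
  have key : y * w - τ * (y * w) * τ = 0 := by
    rw [← mul_assoc, hinv, neg_mul, mul_assoc y, hu, mul_neg, neg_neg, mul_assoc,
      mul_assoc w, hτ', mul_one, sub_self]
  exact ⟨by rw [key, mul_zero], key⟩
end

section
/- Let R be an associative unital ℂ-algebra, τ ∈ R a unit, q ∈ ℂ, φ(u) = τ⁻¹·u·τ, and x ∈ R with Δx = x − φ(x) invertible. Define Q_1(x) = Δx, Q_{k+1}(x) = φ(Q_k(x))·Δx, P_2(x) = x − (1+q)·φ(x) + q·φ²(x), u′_x = (Δx)⁻¹·(u − φ(u)), and the sequence Φ_1(x) = Q_2(x)⁻¹·P_2(x), Φ_{k+1}(x) = (Δx)⁻¹·φ(Φ_k(x))·Δx + q^k·Φ_1(x). Then for every k ≥ 1: (i) Q_k(x) − q^k·φ(Q_k(x)) = Q_{k+1}(x)·Φ_k(x),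 equivalently d((dx)^k) = (dx)^{k+1}·Φ_k(x); and (ii) for every u ∈ R, the differential of the k-form ω = (dx)^k·u, namely dω = τ·((dx)^k·u) − q^k·((dx)^k·u)·τ, satisfies dω = (dx)^{k+1}·(q^k·u′_x + Φ_k(x)·u). -/
/-- Conjugation by a unit moves the unit to the left. -/
theorem mul_unit_eq_unit_mul_conj {R : Type*} [Ring R] (τ : Rˣ) (u : R) :
    u * (τ : R) = τ * ((↑τ⁻¹ : R) * u * τ) := by
  simp only [← mul_assoc, Units.mul_inv, one_mul]


/-- Let `R` be an associative unital ℂ-algebra, `τ` a unit, `q ∈ ℂ`,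
`φ u = τ⁻¹ * u * τ`, and `x ∈ R` with `Δx = x - φ x` invertible.  With
`Q 1 = Δx`, `Q (k+1) = φ (Q k) * Δx`, `P₂ = x - (1+q)•φ(x) + q•φ²(x)`,
`u′_x = (Δx)⁻¹ * (u - φ u)`, `Φ 1 = Q₂⁻¹ * P₂` and
`Φ (k+1) = (Δx)⁻¹ * φ (Φ k) * Δx + q^k • Φ 1`, one has for every `k ≥ 1`:
(i) `Q k - q^k • φ (Q k) = Q (k+1) * Φ k`, equivalently
`d((dx)^k) = (dx)^(k+1) * Φ k` where `dx = τ * Δx`; and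
(ii) for every `u`, the differential of the `k`-form `ω = (dx)^k * u`,
`dω = τ * ((dx)^k * u) - q^k • (((dx)^k * u) * τ)`, satisfies
`dω = (dx)^(k+1) * (q^k • u′_x + Φ k * u)`. -/
theorem differential_of_k_form
    (R : Type*) [Ring R] [Algebra ℂ R]
    (τ : Rˣ) (q : ℂ) (φ : R → R)
    (hφ : ∀ u : R, φ u = (↑τ⁻¹ : R) * u * (τ : R))
    (x : R) (hx : IsUnit (x - φ x))
    (Q : ℕ → R)
    (hQ1 : Q 1 = x - φ x)
    (hQrec : ∀ k : ℕ, 1 ≤ k → Q (k + 1) = φ (Q k) * (x - φ x))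
    (Φ : ℕ → R)
    (hΦ1 : Φ 1 = Ring.inverse (Q 2) * (x - (1 + q) • φ x + q • φ (φ x)))
    (hΦrec : ∀ k : ℕ, 1 ≤ k →
      Φ (k + 1) = Ring.inverse (x - φ x) * φ (Φ k) * (x - φ x) + q ^ k • Φ 1) :
    ∀ k : ℕ, 1 ≤ k →
      (Q k - q ^ k • φ (Q k) = Q (k + 1) * Φ k) ∧
      ((τ : R) * ((τ : R) * (x - φ x)) ^ k
          - q ^ k • (((τ : R) * (x - φ x)) ^ k * (τ : R)) =
        ((τ : R) * (x - φ x)) ^ (k + 1) * Φ k) ∧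
      (∀ u : R,
        (τ : R) * (((τ : R) * (x - φ x)) ^ k * u)
            - q ^ k • ((((τ : R) * (x - φ x)) ^ k * u) * (τ : R)) =
          ((τ : R) * (x - φ x)) ^ (k + 1) *
            (q ^ k • (Ring.inverse (x - φ x) * (u - φ u)) + Φ k * u)) := by
  have hτ (u : R) : u * (τ : R) = τ * φ u := by
    rw [hφ]; exact mul_unit_eq_unit_mul_conj τ u
  have hmul (u v : R) : φ (u * v) = φ u * φ v := by
    simp only [hφ, mul_assoc, Units.mul_inv_cancel_left]
  have hsub (u v : R) : φ (u - v) = φ u - φ v := by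
    simp only [hφ, mul_sub, sub_mul]
  have hsmul (c : ℂ) (u : R) : φ (c • u) = c • φ u := by
    simp only [hφ, mul_smul_comm, smul_mul_assoc]
  have hunit {u : R} (hu : IsUnit u) : IsUnit (φ u) := by
    rw [hφ]; exact (τ⁻¹.isUnit.mul hu).mul τ.isUnit
  have hP : x - (1 + q) • φ x + q • φ (φ x) = (x - φ x) - q • φ (x - φ x) := by
    rw [hsub]; module
  rw [hP] at hΦ1
  generalize x - φ x = D at *
  have hQ2 : Q 2 = φ D * D := by rw [hQrec 1 le_rfl, hQ1]
  have hbase : φ D * D * Φ 1 = D - q • φ D := by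
    rw [hΦ1, hQ2, Ring.mul_inverse_cancel_left _ _ ((hunit hx).mul hx)]
  have hrel (k : ℕ) (hk : 1 ≤ k) : Q k - q ^ k • φ (Q k) = Q (k + 1) * Φ k := by
    induction k, hk using Nat.le_induction with
    | base => rw [hQ2, hbase, hQ1, pow_one]
    | succ k hk ih =>
      have hleft : φ (Q (k + 1)) * φ (Φ k) = φ (Q k) - q ^ k • φ (φ (Q k)) := by
        rw [← hmul, ← ih, hsub, hsmul]
      have hright : φ (Q (k + 1)) * D * Φ 1 = φ (φ (Q k)) * (D - q • φ D) := by
        rw [← hbase, hQrec k hk, hmul]; simp only [mul_assoc]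
      symm
      calc Q (k + 1 + 1) * Φ (k + 1)
          = φ (Q (k + 1)) * (D * (Ring.inverse D * (φ (Φ k) * D)))
              + q ^ k • (φ (Q (k + 1)) * D * Φ 1) := by
            rw [hQrec (k + 1) (by lia), hΦrec k hk]
            simp only [mul_add, mul_smul_comm, mul_assoc]
        _ = (φ (Q k) - q ^ k • φ (φ (Q k))) * D
              + q ^ k • (φ (φ (Q k)) * (D - q • φ D)) := by
            rw [Ring.mul_inverse_cancel_left _ _ hx, ← mul_assoc, hleft, hright]
        _ = Q (k + 1) - q ^ (k + 1) • φ (Q (k + 1)) := by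
            rw [hQrec k hk, hmul]
            simp only [sub_mul, mul_sub, mul_smul_comm, smul_mul_assoc]
            module
  have hpow (k : ℕ) (hk : 1 ≤ k) : ((τ : R) * D) ^ k = (τ : R) ^ k * Q k := by
    induction k, hk using Nat.le_induction with
    | base => rw [hQ1, pow_one, pow_one]
    | succ k hk ih =>
      rw [pow_succ, ih, hQrec k hk, pow_succ]
      simp only [mul_assoc]
      rw [← mul_assoc (Q k), hτ, mul_assoc]
  intro k hk
  have hd : (τ : R) * ((τ : R) * D) ^ k - q ^ k • (((τ : R) * D) ^ k * (τ : R)) =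
      ((τ : R) * D) ^ (k + 1) * Φ k := by
    rw [hpow k hk, hpow (k + 1) (by lia), mul_assoc _ (Q (k + 1)), ← hrel k hk, mul_assoc _ (Q k),
      hτ, ← mul_assoc, ← mul_assoc, ← pow_succ', ← pow_succ, mul_sub, mul_smul_comm]
  refine ⟨hrel k hk, hd, fun u => ?_⟩
  have hderiv : ((τ : R) * D) ^ (k + 1) * (Ring.inverse D * (u - φ u)) =
      ((τ : R) * D) ^ k * ((τ : R) * u) - ((τ : R) * D) ^ k * (u * (τ : R)) := by
    rw [pow_succ, mul_assoc, mul_assoc, Ring.mul_inverse_cancel_left _ _ hx, mul_sub, ← hτ,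
      mul_sub]
  rw [mul_add, mul_smul_comm, hderiv, ← mul_assoc _ (Φ k) u, ← hd]
  simp only [sub_mul, smul_mul_assoc, mul_assoc]
  module
end
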